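/- Let m, n ≥ 1, 1 ≤ k ≤ m, and let Ω(t) := ½‖t‖₂² + δ_{B_k}(t). Then for all a ∈ △^m, b ∈ △^n and all C ∈ ℝ^{m×n} with non-negative entries, the dual and semi-dual of the sparsity-constrained problem coincide and equal the primal with squared k-support norm regularization, which lower-bounds the sparsity-constrained primal: D_Ω(a,b,C) = S_Ω(a,b,C) = P_Ψ(a,b,C) ≤ P_Ω(a,b,C). -/

import Mathlib

open scoped BigOperators Classical

noncomputable section

/-- Inner product of two vectors in `ℝ^m`. -/
def dotp {m : ℕ} (s t : Fin m → ℝ) : ℝ := ∑ i, s i * t i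

/-- The sparsity-constrained quadratic regularizer
`Ω(t) = ½‖t‖₂² + δ_{B_k}(t)`, valued in the extended reals. -/
def OmegaSparse (m k : ℕ) (t : Fin m → ℝ) : EReal :=
  if (Finset.univ.filter (fun i => t i ≠ 0)).card ≤ k then
    (((1 : ℝ) / 2 * ∑ i, (t i) ^ 2 : ℝ) : EReal)
  else ⊤

/-- The squared `k`-support norm
`Ψ(t) = ½ · inf { Σ_i t_i²/λ_i : λ ∈ ℝ^m, 0 < λ_i ≤ 1, Σ_i λ_i = k }`. -/
def Psi (m k : ℕ) (t : Fin m → ℝ) : ℝ :=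
  (1 / 2) * sInf {v : ℝ | ∃ lam : Fin m → ℝ,
    (∀ i, 0 < lam i ∧ lam i ≤ 1) ∧ (∑ i, lam i) = (k : ℝ) ∧
    v = ∑ i, (t i) ^ 2 / lam i}

/-- The conjugate `Ω₊*(s) = sup_{t ≥ 0} ⟨s,t⟩ − Ω(t)`, valued in the extended reals. -/
def conjPlus {m : ℕ} (Ω : (Fin m → ℝ) → EReal) (s : Fin m → ℝ) : EReal :=
  ⨆ t : {t : Fin m → ℝ // ∀ i, 0 ≤ t i}, ((dotp s t.1 : ℝ) : EReal) - Ω t.1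

/-- The conjugate `Ω_b*(s) = sup_{t ∈ b△^m} ⟨s,t⟩ − Ω(t)`, valued in the extended reals. -/
def conjSimplex {m : ℕ} (Ω : (Fin m → ℝ) → EReal) (b : ℝ) (s : Fin m → ℝ) : EReal :=
  ⨆ t : {t : Fin m → ℝ // (∀ i, 0 ≤ t i) ∧ ∑ i, t i = b},
    ((dotp s t.1 : ℝ) : EReal) - Ω t.1

/-- The dual value `D_Ω(a,b,C)`. -/
def dualVal {m n : ℕ} (Ω : (Fin m → ℝ) → EReal) (a : Fin m → ℝ) (b : Fin n → ℝ)
    (C : Fin m → Fin n → ℝ) : EReal :=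
  ⨆ α : Fin m → ℝ, ⨆ β : Fin n → ℝ,
    ((dotp α a : ℝ) : EReal) + ((dotp β b : ℝ) : EReal)
      - ∑ j, conjPlus Ω (fun i => α i + β j - C i j)

/-- The semi-dual value `S_Ω(a,b,C)`. -/
def semiDualVal {m n : ℕ} (Ω : (Fin m → ℝ) → EReal) (a : Fin m → ℝ) (b : Fin n → ℝ)
    (C : Fin m → Fin n → ℝ) : EReal :=
  ⨆ α : Fin m → ℝ,
    ((dotp α a : ℝ) : EReal) - ∑ j, conjSimplex Ω (b j) (fun i => α i - C i j)

/-- The primal value `P_R(a,b,C)` with regularizer `R`, an infimum over the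
transportation polytope `U(a,b)`. -/
def primalVal {m n : ℕ} (R : (Fin m → ℝ) → EReal) (a : Fin m → ℝ) (b : Fin n → ℝ)
    (C : Fin m → Fin n → ℝ) : EReal :=
  ⨅ T : {T : Fin m → Fin n → ℝ //
      (∀ i j, 0 ≤ T i j) ∧ (∀ i, ∑ j, T i j = a i) ∧ (∀ j, ∑ i, T i j = b j)},
    ((∑ i, ∑ j, C i j * T.1 i j : ℝ) : EReal) + ∑ j, R (fun i => T.1 i j)

/-- Every real vector has `k` coordinates that dominate all the others. -/
lemma exists_top_coords {m k : ℕ} (hk : 1 ≤ k) (hkm : k ≤ m) (s : Fin m → ℝ) :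
    ∃ (K : Finset (Fin m)) (θ : ℝ), K.card = k ∧ (∀ i ∈ K, θ ≤ s i) ∧ ∀ i ∉ K, s i ≤ θ := by
  have hmono := Tuple.monotone_sort s
  set σ := Tuple.sort s
  let p : Fin m := ⟨m - k, by omega⟩
  refine ⟨(Finset.Ici p).map σ.toEmbedding, s (σ p), ?_, ?_, ?_⟩
  · rw [Finset.card_map, Fin.card_Ici]
    show m - (m - k) = k
    omega
  · intro i hi
    obtain ⟨j, hj, rfl⟩ := Finset.mem_map.1 hi
    exact hmono (Finset.mem_Ici.1 hj)
  · intro i hi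
    have h : ¬ p ≤ σ.symm i := fun h =>
      hi (Finset.mem_map.2 ⟨σ.symm i, Finset.mem_Ici.2 h, by simp⟩)
    have := hmono (not_le.1 h).le
    simpa using this

/-- A `[0,1]`-weighting of total mass at most `|K|` sums to at most the sum over the top
coordinates `K`. -/
lemma sum_mul_le_sum_top {m : ℕ} (K : Finset (Fin m)) (g lam : Fin m → ℝ) (θ : ℝ)
    (hθ : 0 ≤ θ) (hK : ∀ i ∈ K, θ ≤ g i) (hK' : ∀ i ∉ K, g i ≤ θ)
    (hlam : ∀ i, 0 ≤ lam i ∧ lam i ≤ 1) (hsum : ∑ i, lam i ≤ K.card) :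
    ∑ i, lam i * g i ≤ ∑ i ∈ K, g i := by
  have h1 : ∀ i, lam i * g i - (if i ∈ K then g i else 0)
      ≤ (lam i - if i ∈ K then 1 else 0) * θ := by
    intro i
    obtain ⟨h0, h1⟩ := hlam i
    split_ifs with hi
    · nlinarith [hK i hi]
    · nlinarith [hK' i hi]
  have h2 := Finset.sum_le_sum fun i (_ : i ∈ Finset.univ) => h1 i
  rw [Finset.sum_sub_distrib, ← Finset.sum_mul, Finset.sum_sub_distrib] at h2
  simp only [Finset.sum_ite_mem, Finset.univ_inter, Finset.sum_const, nsmul_eq_mul,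
    mul_one] at h2
  nlinarith

/-- The sparse maximizer `t = [s - τ]₊` on the top-`k` coordinates, with its multiplier `τ`,
and the resulting bound on the weighted quadratic objectives. -/
lemma exists_sparse_maximizer {m k : ℕ} (hk : 1 ≤ k) (hkm : k ≤ m) (s : Fin m → ℝ)
    {b : ℝ} (hb : 0 ≤ b) :
    ∃ (τ : ℝ) (t : Fin m → ℝ), (∀ i, 0 ≤ t i) ∧ ∑ i, t i = b ∧
      (Finset.univ.filter (fun i => t i ≠ 0)).card ≤ k ∧
      dotp s t = ∑ i, t i ^ 2 + τ * b ∧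
      ∀ lam : Fin m → ℝ, (∀ i, 0 ≤ lam i ∧ lam i ≤ 1) → ∑ i, lam i ≤ k →
        ∀ x : Fin m → ℝ, (∀ i, 0 ≤ x i) → (∀ i, lam i = 0 → x i = 0) →
          ∑ i, (s i - τ) * x i - 1 / 2 * ∑ i, x i ^ 2 / lam i ≤ 1 / 2 * ∑ i, t i ^ 2 := by
  obtain ⟨K, θ, hcard, hK, hK'⟩ := exists_top_coords hk hkm s
  obtain ⟨i₀, hi₀⟩ : K.Nonempty := Finset.card_pos.1 (by omega)
  obtain ⟨τ, hτ⟩ : b ∈ Set.range fun τ : ℝ => ∑ i ∈ K, max (s i - τ) 0 := by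
    refine mem_range_of_exists_le_of_exists_ge (by fun_prop) ⟨∑ i, |s i|, ?_⟩ ⟨s i₀ - b, ?_⟩
    · refine (Finset.sum_eq_zero fun i _ => max_eq_right ?_).trans_le hb
      have := Finset.single_le_sum (f := fun i => |s i|) (fun i _ => abs_nonneg _)
        (Finset.mem_univ i)
      linarith [le_abs_self (s i)]
    · have := Finset.single_le_sum (f := fun i => max (s i - (s i₀ - b)) 0)
        (fun i _ => le_max_right _ _) hi₀
      refine le_trans ?_ this
      simp
  have hτ' : ∑ i ∈ K, max (s i - τ) 0 = b := hτ
  set t : Fin m → ℝ := fun i => if i ∈ K then max (s i - τ) 0 else 0 with ht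
  have hsumt : ∑ i, t i = b := by
    simp only [ht, Finset.sum_ite_mem, Finset.univ_inter, hτ']
  have hsq : ∑ i, t i ^ 2 = ∑ i ∈ K, max (s i - τ) 0 ^ 2 := by
    rw [← Finset.univ_inter K, ← Finset.sum_ite_mem]
    exact Finset.sum_congr rfl fun i _ => by simp only [ht]; split_ifs <;> simp
  refine ⟨τ, t, ?_, hsumt, ?_, ?_, ?_⟩
  · intro i
    simp only [ht]
    split_ifs
    · exact le_max_right _ _
    · exact le_rfl
  · rw [← hcard]
    refine Finset.card_le_card fun i hi => ?_
    by_contra h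
    exact (Finset.mem_filter.1 hi).2 (by simp [ht, h])
  · rw [← hsumt, Finset.mul_sum, ← Finset.sum_add_distrib, dotp]
    refine Finset.sum_congr rfl fun i _ => ?_
    simp only [ht]
    split_ifs
    · rcases max_choice (s i - τ) 0 with h | h <;> rw [h] <;> ring
    · simp
  · intro lam hlam hsum x hx h0
    have h1 := sum_mul_le_sum_top K (fun i => max (s i - τ) 0 ^ 2) lam (max (θ - τ) 0 ^ 2)
      (by positivity)
      (fun i hi => by
        have := hK i hi
        gcongr)
      (fun i hi => by
        have := hK' i hi
        gcongr) hlam (by rwa [hcard])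
    rw [hsq]
    refine le_trans ?_ (mul_le_mul_of_nonneg_left h1 (by norm_num))
    rw [Finset.mul_sum, Finset.mul_sum, ← Finset.sum_sub_distrib]
    refine Finset.sum_le_sum fun i _ => ?_
    rcases (hlam i).1.eq_or_lt with h | h
    · rw [h0 i h.symm, ← h]; simp
    · have e : (s i - τ) * x i ≤ max (s i - τ) 0 * x i :=
        mul_le_mul_of_nonneg_right (le_max_left _ _) (hx i)
      have e2 : x i ^ 2 / lam i = lam i * (x i / lam i) ^ 2 := by field_simp
      have e3 : x i = lam i * (x i / lam i) := by field_simp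
      generalize x i / lam i = y at e2 e3
      rw [e2]
      rw [e3] at e ⊢
      nlinarith [mul_nonneg h.le (sq_nonneg (max (s i - τ) 0 - y))]

/-- The values whose infimum is `2Ψ(t)`. -/
def psiSet (m k : ℕ) (t : Fin m → ℝ) : Set ℝ :=
  {v : ℝ | ∃ lam : Fin m → ℝ,
    (∀ i, 0 < lam i ∧ lam i ≤ 1) ∧ (∑ i, lam i) = (k : ℝ) ∧ v = ∑ i, (t i) ^ 2 / lam i}

lemma Psi_eq (m k : ℕ) (t : Fin m → ℝ) : Psi m k t = 1 / 2 * sInf (psiSet m k t) := rfl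

lemma psiSet_nonneg {m k : ℕ} {t : Fin m → ℝ} {v : ℝ} (hv : v ∈ psiSet m k t) : 0 ≤ v := by
  obtain ⟨lam, hlam, -, rfl⟩ := hv
  exact Finset.sum_nonneg fun i _ => div_nonneg (sq_nonneg _) (hlam i).1.le

lemma psiSet_bddBelow (m k : ℕ) (t : Fin m → ℝ) : BddBelow (psiSet m k t) :=
  ⟨0, fun _ => psiSet_nonneg⟩

lemma psiSet_nonempty {m k : ℕ} (hk : 1 ≤ k) (hkm : k ≤ m) (t : Fin m → ℝ) :
    (psiSet m k t).Nonempty := by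
  have hk' : (0 : ℝ) < k := by exact_mod_cast hk
  have hkm' : (k : ℝ) ≤ m := by exact_mod_cast hkm
  have hm' : (0 : ℝ) < m := hk'.trans_le hkm'
  refine ⟨_, fun _ => (k : ℝ) / m, fun _ => ⟨by positivity, (div_le_one hm').2 hkm'⟩, ?_, rfl⟩
  simp only [Finset.sum_const, Finset.card_univ, Fintype.card_fin, nsmul_eq_mul]
  field_simp

/-- On `k`-sparse vectors `Ψ` is at most half the squared Euclidean norm. -/
lemma Psi_le_of_sparse {m k : ℕ} (hk : 1 ≤ k) (hkm : k ≤ m) (t : Fin m → ℝ)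
    (ht : (Finset.univ.filter (fun i => t i ≠ 0)).card ≤ k) :
    Psi m k t ≤ 1 / 2 * ∑ i, t i ^ 2 := by
  have hk' : (0 : ℝ) < k := by exact_mod_cast hk
  have hkm' : (k : ℝ) ≤ m := by exact_mod_cast hkm
  have hm' : (0 : ℝ) < m := hk'.trans_le hkm'
  have hq : (k : ℝ) / m ≤ 1 := (div_le_one hm').2 hkm'
  have hq0 : 0 < (k : ℝ) / m := by positivity
  obtain ⟨K, hsub, hcard⟩ := Finset.exists_superset_card_eq ht (by simpa using hkm)
  set N := ∑ i, t i ^ 2 with hN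
  have hN0 : 0 ≤ N := Finset.sum_nonneg fun i _ => sq_nonneg _
  have key : ∀ ε : ℝ, 0 < ε → ε < 1 → (1 - ε) * sInf (psiSet m k t) ≤ N := by
    intro ε h0 h1
    have hmem : ∑ i, t i ^ 2 / ((1 - ε) * (if i ∈ K then 1 else 0) + ε * (k / m))
        ∈ psiSet m k t := by
      refine ⟨_, fun i => ?_, ?_, rfl⟩
      · have hp : 0 < ε * ((k : ℝ) / m) := by positivity
        split_ifs <;> constructor <;> nlinarith
      · rw [Finset.sum_add_distrib, ← Finset.mul_sum]
        simp only [Finset.sum_ite_mem, Finset.univ_inter, Finset.sum_const, nsmul_eq_mul,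
          mul_one, hcard, Finset.card_univ, Fintype.card_fin]
        field_simp
        ring
    have h2 := csInf_le (psiSet_bddBelow m k t) hmem
    refine (mul_le_mul_of_nonneg_left h2 (by linarith)).trans ?_
    rw [Finset.mul_sum, hN]
    refine Finset.sum_le_sum fun i _ => ?_
    by_cases hi : t i = 0
    · simp [hi]
    · have hiK : i ∈ K := hsub (by simp [hi])
      have hp : 0 < ε * ((k : ℝ) / m) := by positivity
      rw [if_pos hiK, mul_one, ← mul_div_assoc, div_le_iff₀ (by linarith)]
      nlinarith [sq_nonneg (t i), mul_nonneg (sq_nonneg (t i)) hp.le]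
  rw [Psi_eq]
  refine mul_le_mul_of_nonneg_left ?_ (by norm_num)
  by_contra! h
  set S := sInf (psiSet m k t)
  have hS : 0 < S := hN0.trans_lt h
  have := key ((S - N) / (2 * S)) (by apply div_pos <;> linarith)
    (by rw [div_lt_one (by linarith)]; linarith)
  have e : (1 - (S - N) / (2 * S)) * S = (S + N) / 2 := by field_simp; ring
  linarith

lemma sq_div_convex {u v x y p q : ℝ} (hu : 0 ≤ u) (hv : 0 ≤ v) (huv : u + v = 1)
    (hp : 0 < p) (hq : 0 < q) :
    (u * x + v * y) ^ 2 / (u * p + v * q) ≤ u * (x ^ 2 / p) + v * (y ^ 2 / q) := by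
  have hpos : 0 < u * p + v * q := by
    rcases hu.eq_or_lt with h | h
    · have : v = 1 := by linarith
      subst this; rw [← h]; linarith
    · have := mul_pos h hp; have := mul_nonneg hv hq.le; linarith
  rw [div_le_iff₀ hpos]
  have ex : x ^ 2 / p = p * (x / p) ^ 2 := by field_simp
  have ey : y ^ 2 / q = q * (y / q) ^ 2 := by field_simp
  have hx : x = p * (x / p) := by field_simp
  have hy : y = q * (y / q) := by field_simp
  rw [ex, ey]
  generalize x / p = z at *
  generalize y / q = w at *
  rw [hx, hy]
  have : 0 ≤ u * v * (p * q) * (z - w) ^ 2 := by positivity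
  nlinarith

/-- The squared `k`-support norm is convex. -/
lemma Psi_convexOn {m k : ℕ} (hk : 1 ≤ k) (hkm : k ≤ m) :
    ConvexOn ℝ Set.univ (Psi m k) := by
  refine ⟨convex_univ, fun x _ y _ u v hu hv huv => ?_⟩
  simp only [Psi_eq, smul_eq_mul]
  suffices h : sInf (psiSet m k (u • x + v • y))
      ≤ u * sInf (psiSet m k x) + v * sInf (psiSet m k y) by linarith
  refine le_of_forall_pos_le_add fun ε hε => ?_
  obtain ⟨_, ⟨p, hp, hps, rfl⟩, hpl⟩ := Real.lt_sInf_add_pos (psiSet_nonempty hk hkm x) hε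
  obtain ⟨_, ⟨q, hq, hqs, rfl⟩, hql⟩ := Real.lt_sInf_add_pos (psiSet_nonempty hk hkm y) hε
  have hmem : ∑ i, (u • x + v • y) i ^ 2 / (u * p i + v * q i)
      ∈ psiSet m k (u • x + v • y) := by
    refine ⟨_, fun i => ⟨?_, ?_⟩, ?_, rfl⟩
    · exact (convex_Ioi (0 : ℝ)) (hp i).1 (hq i).1 hu hv huv
    · exact (convex_Iic (1 : ℝ)) (hp i).2 (hq i).2 hu hv huv
    · rw [Finset.sum_add_distrib, ← Finset.mul_sum, ← Finset.mul_sum, hps, hqs, ← add_mul, huv,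
        one_mul]
  refine (csInf_le (psiSet_bddBelow m k _) hmem).trans ?_
  have h1 : ∑ i, (u • x + v • y) i ^ 2 / (u * p i + v * q i)
      ≤ u * ∑ i, x i ^ 2 / p i + v * ∑ i, y i ^ 2 / q i := by
    rw [Finset.mul_sum, Finset.mul_sum, ← Finset.sum_add_distrib]
    exact Finset.sum_le_sum fun i _ => sq_div_convex hu hv huv (hp i).1 (hq i).1
  nlinarith

lemma Psi_continuous {m k : ℕ} (hk : 1 ≤ k) (hkm : k ≤ m) : Continuous (Psi m k) :=
  continuousOn_univ.1 ((Psi_convexOn hk hkm).continuousOn isOpen_univ)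

/-- The conjugate over the simplex is finite and attained, bounds the one over the orthant after
a shift, and dominates `⟨s, ·⟩ - Ψ` on the simplex. -/
lemma conjSimplex_spec {m k : ℕ} (hk : 1 ≤ k) (hkm : k ≤ m) (s : Fin m → ℝ)
    {b : ℝ} (hb : 0 ≤ b) :
    ∃ (v τ : ℝ) (t : Fin m → ℝ), (∀ i, 0 ≤ t i) ∧ ∑ i, t i = b ∧
      (Finset.univ.filter (fun i => t i ≠ 0)).card ≤ k ∧
      v = dotp s t - 1 / 2 * ∑ i, t i ^ 2 ∧
      conjSimplex (OmegaSparse m k) b s = (v : EReal) ∧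
      conjPlus (OmegaSparse m k) (fun i => s i - τ) ≤ ((v - τ * b : ℝ) : EReal) ∧
      ∀ x : Fin m → ℝ, (∀ i, 0 ≤ x i) → ∑ i, x i = b → dotp s x - Psi m k x ≤ v := by
  obtain ⟨τ, t, ht0, htb, htk, hdot, hmax⟩ := exists_sparse_maximizer hk hkm s hb
  have hsparse : ∀ x : Fin m → ℝ, (∀ i, 0 ≤ x i) →
      (Finset.univ.filter (fun i => x i ≠ 0)).card ≤ k →
      ∑ i, (s i - τ) * x i - 1 / 2 * ∑ i, x i ^ 2 ≤ 1 / 2 * ∑ i, t i ^ 2 := by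
    intro x hx hxk
    have h := hmax (fun i => if x i ≠ 0 then 1 else 0)
      (fun i => by split_ifs <;> norm_num)
      (by rw [Finset.sum_boole]; exact_mod_cast hxk) x hx
      (fun i hi => by by_contra h; simp [h] at hi)
    have e : ∑ i, x i ^ 2 / (if x i ≠ 0 then (1 : ℝ) else 0) = ∑ i, x i ^ 2 :=
      Finset.sum_congr rfl fun i _ => by by_cases h : x i = 0 <;> simp [h]
    rwa [e] at h
  have hshift : ∀ x : Fin m → ℝ, ∑ i, x i = b →
      ∑ i, (s i - τ) * x i = dotp s x - τ * b := by
    intro x hx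
    simp only [sub_mul, Finset.sum_sub_distrib, ← Finset.mul_sum, hx, dotp]
  refine ⟨_, τ, t, ht0, htb, htk, rfl, ?_, ?_, ?_⟩
  · refine le_antisymm (iSup_le ?_) ?_
    · rintro ⟨x, hx0, hxb⟩
      simp only [OmegaSparse]
      split_ifs with hxk
      · have := hsparse x hx0 hxk
        rw [hshift x hxb] at this
        rw [← EReal.coe_sub, EReal.coe_le_coe_iff]
        linarith
      · simp
    · refine le_iSup_of_le ⟨t, ht0, htb⟩ ?_
      simp only [OmegaSparse, if_pos htk]
      rw [EReal.coe_sub]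
  · refine iSup_le ?_
    rintro ⟨x, hx0⟩
    simp only [OmegaSparse]
    split_ifs with hxk
    · have := hsparse x hx0 hxk
      rw [← EReal.coe_sub, EReal.coe_le_coe_iff]
      simp only [dotp] at *
      linarith
    · simp
  · intro x hx0 hxb
    suffices h : 2 * (dotp s x - (dotp s t - 1 / 2 * ∑ i, t i ^ 2)) ≤ sInf (psiSet m k x) by
      rw [Psi_eq]; linarith
    refine le_csInf (psiSet_nonempty hk hkm x) ?_
    rintro _ ⟨lam, hlam, hsum, rfl⟩
    have := hmax lam (fun i => ⟨(hlam i).1.le, (hlam i).2⟩) hsum.le x hx0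
      (fun i hi => absurd hi (hlam i).1.ne')
    rw [hshift x hxb] at this
    linarith

lemma coe_sum_EReal {ι : Type*} (A : Finset ι) (f : ι → ℝ) :
    ((∑ j ∈ A, f j : ℝ) : EReal) = ∑ j ∈ A, (f j : EReal) :=
  map_sum (⟨⟨Real.toEReal, EReal.coe_zero⟩, EReal.coe_add⟩ : ℝ →+ EReal) f A

/-- Strong duality for a convex objective under linear equality constraints on a compact convex
set: any lower bound of the constrained values is reached by a Lagrange multiplier. -/
lemma exists_multiplier {E : Type*} [NormedAddCommGroup E] [NormedSpace ℝ E] {m : ℕ}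
    {X : Set E} (hXc : IsCompact X) (hXv : Convex ℝ X)
    {F : E → ℝ} (hFc : Continuous F) (hFv : ConvexOn ℝ X F)
    (L : E →L[ℝ] (Fin m → ℝ)) (a : Fin m → ℝ) (hfeas : ∃ T ∈ X, L T = a)
    {r : ℝ} (hr : ∀ T ∈ X, L T = a → r < F T) :
    ∃ α : Fin m → ℝ, ∀ T ∈ X, r < dotp α a - dotp α (L T) + F T := by
  set A : Set ((Fin m → ℝ) × ℝ) := {p | ∃ T ∈ X, p.1 = L T - a ∧ F T ≤ p.2} with hA
  have hconv : Convex ℝ A := by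
    rintro p ⟨T, hT, hp1, hp2⟩ q ⟨T', hT', hq1, hq2⟩ u v hu hv huv
    refine ⟨u • T + v • T', hXv hT hT' hu hv huv, ?_, ?_⟩
    · have e : a = u • a + v • a := by rw [← add_smul, huv, one_smul]
      simp only [Prod.fst_add, Prod.smul_fst, hp1, hq1, map_add, map_smul]
      nth_rewrite 3 [e]
      module
    · refine (hFv.2 hT hT' hu hv huv).trans ?_
      simp only [Prod.snd_add, Prod.smul_snd, smul_eq_mul]
      gcongr
  have hclosed : IsClosed A := by
    have hK : IsCompact ((fun T => (L T - a, F T)) '' X) :=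
      hXc.image (by fun_prop)
    have hcone : IsClosed ({0} ×ˢ Set.Ici 0 : Set ((Fin m → ℝ) × ℝ)) :=
      isClosed_singleton.prod isClosed_Ici
    convert hcone.add_left_of_isCompact hK using 1
    ext p
    constructor
    · rintro ⟨T, hT, h1, h2⟩
      refine ⟨_, ⟨T, hT, rfl⟩, (0, p.2 - F T), ⟨rfl, sub_nonneg.2 h2⟩, ?_⟩
      ext <;> simp [h1]
    · rintro ⟨_, ⟨T, hT, rfl⟩, q, ⟨hq1, hq2⟩, rfl⟩
      have hq1 : q.1 = 0 := hq1
      have hq2 : 0 ≤ q.2 := hq2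
      exact ⟨T, hT, by simp [hq1], by simpa using hq2⟩
  have hnot : ((0 : Fin m → ℝ), r) ∉ A := by
    rintro ⟨T, hT, h1, h2⟩
    exact (hr T hT (sub_eq_zero.1 h1.symm)).not_ge h2
  obtain ⟨f, u, hfr, hfA⟩ := geometric_hahn_banach_point_closed hconv hclosed hnot
  have hf : ∀ x y, f (x, y) = f (x, 0) + y * f (0, 1) := by
    intro x y
    have : (x, y) = (x, 0) + y • ((0 : Fin m → ℝ), (1 : ℝ)) := by ext <;> simp
    rw [this, map_add, map_smul, smul_eq_mul]
  set ρ := f (0, 1)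
  have hw : ∀ x : Fin m → ℝ, f (x, 0) = ∑ i, x i * f (Pi.single i 1, 0) := by
    intro x
    have := LinearMap.pi_apply_eq_sum_univ
      ((f : ((Fin m → ℝ) × ℝ) →ₗ[ℝ] ℝ).comp (LinearMap.inl ℝ (Fin m → ℝ) ℝ)) x
    have e : ∀ i : Fin m, (fun j => if i = j then (1 : ℝ) else 0) = Pi.single i 1 := by
      intro i; ext j; simp [Pi.single_apply, eq_comm]
    simpa only [e, LinearMap.comp_apply, LinearMap.inl_apply, ContinuousLinearMap.coe_coe,
      smul_eq_mul] using this
  have hlt : ∀ T ∈ X, r * ρ < f (L T - a, 0) + F T * ρ := by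
    intro T hT
    have h := hfr.trans (hfA (L T - a, F T) ⟨T, hT, rfl, le_rfl⟩)
    rw [hf 0 r, hf (L T - a) (F T)] at h
    have h0 : f ((0 : Fin m → ℝ), (0 : ℝ)) = 0 := map_zero f
    linarith
  have hρ : 0 < ρ := by
    obtain ⟨T, hT, hLT⟩ := hfeas
    have h := hlt T hT
    have h0 : f ((0 : Fin m → ℝ), (0 : ℝ)) = 0 := map_zero f
    rw [hLT, sub_self, h0] at h
    nlinarith [hr T hT hLT]
  refine ⟨fun i => -f (Pi.single i 1, 0) / ρ, fun T hT => ?_⟩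
  have h := hlt T hT
  rw [hw] at h
  have e : dotp (fun i => -f (Pi.single i 1, 0) / ρ) a
      - dotp (fun i => -f (Pi.single i 1, 0) / ρ) (L T)
      = (∑ i, (L T - a) i * f (Pi.single i 1, 0)) / ρ := by
    simp only [dotp, Finset.sum_div, ← Finset.sum_sub_distrib, Pi.sub_apply]
    exact Finset.sum_congr rfl fun i _ => by ring
  rw [e, ← sub_lt_iff_lt_add, lt_div_iff₀ hρ]
  linarith

/-- Matrices with non-negative entries and column sums `b` form a compact set. -/
lemma isCompact_columnSimplex {m n : ℕ} (b : Fin n → ℝ) :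
    IsCompact {T : Fin m → Fin n → ℝ | (∀ i j, 0 ≤ T i j) ∧ ∀ j, ∑ i, T i j = b j} := by
  refine (isCompact_Icc (a := (0 : Fin m → Fin n → ℝ)) (b := fun _ j => b j)).of_isClosed_subset
    ?_ ?_
  · simp only [Set.ofPred_and, Set.ofPred_forall]
    refine IsClosed.inter (isClosed_iInter fun i => isClosed_iInter fun j => ?_)
      (isClosed_iInter fun j => ?_)
    · exact isClosed_le continuous_const (by fun_prop)
    · exact isClosed_eq (by fun_prop) continuous_const
  · rintro T ⟨h0, hs⟩
    refine ⟨fun i j => h0 i j, fun i j => ?_⟩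
    show T i j ≤ b j
    rw [← hs j]
    exact Finset.single_le_sum (f := fun i => T i j) (fun i _ => h0 i j) (Finset.mem_univ i)

lemma convex_columnSimplex {m n : ℕ} (b : Fin n → ℝ) :
    Convex ℝ {T : Fin m → Fin n → ℝ | (∀ i j, 0 ≤ T i j) ∧ ∀ j, ∑ i, T i j = b j} := by
  rintro T ⟨h0, hs⟩ T' ⟨h0', hs'⟩ u v hu hv huv
  refine ⟨fun i j => ?_, fun j => ?_⟩
  · have := mul_nonneg hu (h0 i j)
    have := mul_nonneg hv (h0' i j)
    simp only [Pi.add_apply, Pi.smul_apply, smul_eq_mul]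
    linarith
  · simp only [Pi.add_apply, Pi.smul_apply, smul_eq_mul, Finset.sum_add_distrib,
      ← Finset.mul_sum, hs, hs', ← add_mul, huv, one_mul]

/-- The linear map sending a matrix to its vector of row sums. -/
def rowSums (m n : ℕ) : (Fin m → Fin n → ℝ) →L[ℝ] (Fin m → ℝ) :=
  ContinuousLinearMap.pi fun i =>
    ∑ j, (ContinuousLinearMap.proj (R := ℝ) (φ := fun _ : Fin n => ℝ) j).comp
      (ContinuousLinearMap.proj (R := ℝ) (φ := fun _ : Fin m => Fin n → ℝ) i)

lemma rowSums_apply {m n : ℕ} (T : Fin m → Fin n → ℝ) (i : Fin m) :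
    rowSums m n T i = ∑ j, T i j := by
  simp [rowSums]

lemma sum_dotp_sub {m n : ℕ} (α : Fin m → ℝ) (C T : Fin m → Fin n → ℝ) :
    ∑ j, dotp (fun i => α i - C i j) (fun i => T i j)
      = dotp α (fun i => ∑ j, T i j) - ∑ i, ∑ j, C i j * T i j := by
  simp only [dotp, sub_mul, Finset.sum_sub_distrib, Finset.mul_sum]
  rw [Finset.sum_comm, Finset.sum_comm (f := fun j i => C i j * T i j)]

/-- The objective of the `Ψ`-regularized primal. -/
def psiObjective {m n : ℕ} (k : ℕ) (C T : Fin m → Fin n → ℝ) : ℝ :=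
  ∑ i, ∑ j, C i j * T i j + ∑ j, Psi m k (fun i => T i j)

lemma psiObjective_continuous {m n k : ℕ} (hk : 1 ≤ k) (hkm : k ≤ m)
    (C : Fin m → Fin n → ℝ) : Continuous (psiObjective k C) := by
  have := Psi_continuous hk hkm
  unfold psiObjective
  fun_prop

lemma psiObjective_convexOn {m n k : ℕ} (hk : 1 ≤ k) (hkm : k ≤ m)
    (C : Fin m → Fin n → ℝ) : ConvexOn ℝ Set.univ (psiObjective k C) := by
  refine ⟨convex_univ, fun T _ T' _ u v hu hv huv => ?_⟩
  have h1 : ∑ j, Psi m k (fun i => (u • T + v • T') i j)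
      ≤ u * ∑ j, Psi m k (fun i => T i j) + v * ∑ j, Psi m k (fun i => T' i j) := by
    rw [Finset.mul_sum, Finset.mul_sum, ← Finset.sum_add_distrib]
    exact Finset.sum_le_sum fun j _ =>
      (Psi_convexOn hk hkm).2 (Set.mem_univ (fun i => T i j)) (Set.mem_univ (fun i => T' i j))
        hu hv huv
  have h2 : ∑ i, ∑ j, C i j * (u • T + v • T') i j
      = u * ∑ i, ∑ j, C i j * T i j + v * ∑ i, ∑ j, C i j * T' i j := by
    simp only [Finset.mul_sum, ← Finset.sum_add_distrib, Pi.add_apply, Pi.smul_apply,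
      smul_eq_mul]
    exact Finset.sum_congr rfl fun i _ => Finset.sum_congr rfl fun j _ => by ring
  simp only [psiObjective, smul_eq_mul, h2]
  linarith

/-- For `Ω = ½‖·‖₂² + δ_{B_k}`, the dual and semi-dual coincide, equal the primal
regularized by the squared `k`-support norm `Ψ`, and lower-bound the
sparsity-constrained primal. -/
theorem sparse_duality {m n k : ℕ} (hm : 1 ≤ m) (hn : 1 ≤ n) (hk : 1 ≤ k) (hkm : k ≤ m)
    (a : Fin m → ℝ) (ha : (∀ i, 0 ≤ a i) ∧ ∑ i, a i = 1)
    (b : Fin n → ℝ) (hb : (∀ j, 0 ≤ b j) ∧ ∑ j, b j = 1)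
    (C : Fin m → Fin n → ℝ) (hC : ∀ i j, 0 ≤ C i j) :
    dualVal (OmegaSparse m k) a b C = semiDualVal (OmegaSparse m k) a b C ∧
    semiDualVal (OmegaSparse m k) a b C
      = primalVal (fun t => ((Psi m k t : ℝ) : EReal)) a b C ∧
    primalVal (fun t => ((Psi m k t : ℝ) : EReal)) a b C
      ≤ primalVal (OmegaSparse m k) a b C := by
  choose v τ t ht0 htb htk hv hconj hplus hpsi using
    fun (α : Fin m → ℝ) (j : Fin n) =>
      conjSimplex_spec hk hkm (fun i => α i - C i j) (hb.1 j)
  have hS : semiDualVal (OmegaSparse m k) a b C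
      = ⨆ α : Fin m → ℝ, ((dotp α a - ∑ j, v α j : ℝ) : EReal) := by
    simp only [semiDualVal, hconj, ← coe_sum_EReal, ← EReal.coe_sub]
  have hP : primalVal (fun t => ((Psi m k t : ℝ) : EReal)) a b C
      = ⨅ T : {T : Fin m → Fin n → ℝ //
          (∀ i j, 0 ≤ T i j) ∧ (∀ i, ∑ j, T i j = a i) ∧ (∀ j, ∑ i, T i j = b j)},
        ((psiObjective k C T.1 : ℝ) : EReal) := by
    simp only [primalVal, psiObjective, ← coe_sum_EReal, ← EReal.coe_add]
  refine ⟨le_antisymm ?_ ?_, le_antisymm ?_ ?_, ?_⟩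
  · rw [hS]
    refine iSup_le fun α => iSup_le fun β => le_iSup_of_le α ?_
    have h1 : ∀ j, ((v α j + β j * b j : ℝ) : EReal)
        ≤ conjPlus (OmegaSparse m k) (fun i => α i + β j - C i j) := by
      intro j
      refine le_iSup_of_le ⟨t α j, ht0 α j⟩ ?_
      simp only [OmegaSparse, if_pos (htk α j)]
      rw [← EReal.coe_sub, EReal.coe_le_coe_iff, hv α j, ← htb α j]
      simp only [dotp]
      have : ∑ i, (α i + β j - C i j) * t α j i
          = ∑ i, (α i - C i j) * t α j i + β j * ∑ i, t α j i := by
        rw [Finset.mul_sum, ← Finset.sum_add_distrib]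
        exact Finset.sum_congr rfl fun i _ => by ring
      linarith
    have h2 := Finset.sum_le_sum fun j (_ : j ∈ Finset.univ) => h1 j
    rw [← coe_sum_EReal] at h2
    refine (EReal.sub_le_sub le_rfl h2).trans ?_
    rw [← EReal.coe_add, ← EReal.coe_sub, EReal.coe_le_coe_iff, Finset.sum_add_distrib, dotp, dotp]
    linarith
  · rw [hS]
    refine iSup_le fun α => le_iSup_of_le α (le_iSup_of_le (fun j => -τ α j) ?_)
    have h2 : ∑ j, conjPlus (OmegaSparse m k) (fun i => α i + -τ α j - C i j)
        ≤ ((∑ j, (v α j - τ α j * b j) : ℝ) : EReal) := by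
      rw [coe_sum_EReal]
      refine Finset.sum_le_sum fun j _ => ?_
      convert hplus α j using 3
      ring
    refine le_trans ?_ (EReal.sub_le_sub le_rfl h2)
    rw [← EReal.coe_add, ← EReal.coe_sub, EReal.coe_le_coe_iff, Finset.sum_sub_distrib]
    simp only [dotp, neg_mul, Finset.sum_neg_distrib]
    linarith
  · rw [hS, hP]
    refine iSup_le fun α => le_iInf fun T => ?_
    obtain ⟨T, hT0, hTa, hTb⟩ := T
    rw [EReal.coe_le_coe_iff]
    have h1 := Finset.sum_le_sum fun j (_ : j ∈ Finset.univ) =>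
      hpsi α j (fun i => T i j) (fun i => hT0 i j) (hTb j)
    rw [Finset.sum_sub_distrib, sum_dotp_sub, funext hTa] at h1
    simp only [psiObjective]
    linarith
  · by_contra! hlt
    obtain ⟨r, hr1, hr2⟩ := EReal.lt_iff_exists_real_btwn.1 hlt
    rw [hP] at hr2
    have hfeas : ∃ T ∈ {T : Fin m → Fin n → ℝ | (∀ i j, 0 ≤ T i j) ∧ ∀ j, ∑ i, T i j = b j},
        rowSums m n T = a := by
      refine ⟨fun i j => a i * b j, ⟨fun i j => mul_nonneg (ha.1 i) (hb.1 j), fun j => ?_⟩, ?_⟩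
      · rw [← Finset.sum_mul, ha.2, one_mul]
      · ext i
        rw [rowSums_apply, ← Finset.mul_sum, hb.2, mul_one]
    obtain ⟨α, hα⟩ := exists_multiplier (isCompact_columnSimplex b) (convex_columnSimplex b)
      (psiObjective_continuous hk hkm C)
      ((psiObjective_convexOn hk hkm C).subset (Set.subset_univ _) (convex_columnSimplex b))
      (rowSums m n) a hfeas (r := r) (fun T hT hTa => by
        have := hr2.trans_le (iInf_le _ ⟨T, hT.1, fun i => by rw [← rowSums_apply, hTa], hT.2⟩)
        exact_mod_cast this)
    have h1 := hα (fun i j => t α j i) ⟨fun i j => ht0 α j i, fun j => htb α j⟩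
    have h2 := Finset.sum_le_sum fun j (_ : j ∈ Finset.univ) =>
      Psi_le_of_sparse hk hkm (t α j) (htk α j)
    have h3 := Finset.sum_congr rfl fun j (_ : j ∈ Finset.univ) => hv α j
    rw [Finset.sum_sub_distrib, sum_dotp_sub α C (fun i j => t α j i)] at h3
    rw [funext (rowSums_apply (m := m) (n := n) _)] at h1
    simp only [psiObjective] at h1
    have h4 : ((dotp α a - ∑ j, v α j : ℝ) : EReal) ≤ semiDualVal (OmegaSparse m k) a b C := by
      rw [hS]
      exact le_iSup (fun α : Fin m → ℝ => ((dotp α a - ∑ j, v α j : ℝ) : EReal)) α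
    have h5 := EReal.coe_lt_coe_iff.1 (h4.trans_lt hr1)
    linarith
  · refine iInf_mono fun T => add_le_add le_rfl (Finset.sum_le_sum fun j _ => ?_)
    simp only [OmegaSparse]
    split_ifs with h
    · exact EReal.coe_le_coe_iff.2 (Psi_le_of_sparse hk hkm _ h)
    · exact le_top

end
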